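/- Let f = (f₁,…,f_q) be a tuple of real homogeneous polynomials in n+1 variables with deg fᵢ = dᵢ, set D := max_i dᵢ, and let k ≥ 1 and v₁,…,v_k ∈ ℝ^{n+1}. Then for every x ∈ S^n and every index i, (1/(k!·dᵢ))·|D̄ₓᵏfᵢ(v₁,…,v_k)| ≤ (1/k)·C(D−1, k−1)·‖f‖∞·‖v₁‖₂⋯‖v_k‖₂, where D̄ₓᵏfᵢ is the k-th derivative of fᵢ at x viewed as a symmetric k-multilinear map on ℝ^{n+1} and C(D−1,k−1) is a binomial coefficient. -/

import Mathlib

open MvPolynomial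

noncomputable def vnorm {m : ℕ} (v : Fin m → ℝ) : ℝ := Real.sqrt (∑ j, v j ^ 2)

noncomputable def polySupNorm {n q : ℕ} (f : Fin q → MvPolynomial (Fin (n + 1)) ℝ) : ℝ :=
  ⨆ x : {x : Fin (n + 1) → ℝ // vnorm x = 1}, ⨆ i : Fin q, |eval x.1 (f i)|

/-- The polynomial obtained by differentiating `p` in the direction `v`. -/
noncomputable def dirD {n : ℕ} (v : Fin (n + 1) → ℝ) (p : MvPolynomial (Fin (n + 1)) ℝ) :
    MvPolynomial (Fin (n + 1)) ℝ :=
  ∑ j, MvPolynomial.C (v j) * pderiv j p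

/-- Iterated directional derivative: `iterD k v p` is the `k`-th derivative of `p`
applied to the directions `v 0, …, v (k-1)`. -/
noncomputable def iterD {n : ℕ} : (k : ℕ) → (Fin k → (Fin (n + 1) → ℝ)) →
    MvPolynomial (Fin (n + 1)) ℝ → MvPolynomial (Fin (n + 1)) ℝ
  | 0, _, p => p
  | k + 1, v, p => iterD k (fun l => v l.succ) (dirD (v 0) p)


lemma kel_dd (d : ℕ) (t : ℕ → ℝ) (hd : 1 ≤ d)
    (ht : ∀ j k, j < k → k < d - 1 → t k < t j) (g : Polynomial ℝ) (hg : g.natDegree ≤ d)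
    (hc : 0 < g.coeff d) (hs : ∀ k < d - 1, (-1 : ℝ) ^ k * g.eval (t k) < 0)
    (t0 : ℝ) (h0 : g.eval t0 = 0) (h1 : g.derivative.eval t0 = 0) : False := by
  have hg0 : g ≠ 0 := by rintro rfl; simp at hc
  have hdeg : g.natDegree = d := le_antisymm hg (Polynomial.le_natDegree_of_ne_zero hc.ne')
  have hm := (Polynomial.one_lt_rootMultiplicity_iff_isRoot hg0).2 ⟨h0, h1⟩
  have hdvd : (Polynomial.X - Polynomial.C t0) ^ 2 ∣ g :=
    (Polynomial.le_rootMultiplicity_iff hg0).1 hm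
  obtain ⟨u, hu⟩ := hdvd
  have hmon : ((Polynomial.X - Polynomial.C t0) ^ 2).Monic := (Polynomial.monic_X_sub_C t0).pow 2
  have hu0 : u ≠ 0 := by rintro rfl; simp at hu; exact hg0 hu
  have hdu : d = 2 + u.natDegree := by
    rw [← hdeg, hu, hmon.natDegree_mul' hu0, Polynomial.natDegree_pow]
    simp
  have hlc : u.coeff (d - 2) = g.coeff d := by
    have h2 : g.leadingCoeff = u.leadingCoeff := by
      rw [hu, Polynomial.leadingCoeff_mul, hmon.leadingCoeff, one_mul]
    rw [Polynomial.leadingCoeff, Polynomial.leadingCoeff, hdeg] at h2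
    rw [h2]; congr 1; omega
  have hinj : Set.InjOn t (Finset.range (d - 1) : Finset ℕ) := by
    intro a ha b hb hab
    simp at ha hb
    rcases lt_trichotomy a b with h | h | h
    · have := ht a b h hb; linarith
    · exact h
    · have := ht b a h ha; linarith
  have hsum := Lagrange.coeff_eq_sum (P := u) hinj (by
    rw [Polynomial.degree_eq_natDegree hu0, Finset.card_range]; norm_cast; omega)
  rw [Finset.card_range, show d - 1 - 1 = d - 2 by omega, hlc] at hsum
  have hneg : ∀ k ∈ Finset.range (d - 1),
      u.eval (t k) / ∏ j ∈ (Finset.range (d - 1)).erase k, (t k - t j) ≤ 0 := by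
    intro k hk
    have hk' := Finset.mem_range.1 hk
    have hprod : ∏ j ∈ (Finset.range (d - 1)).erase k, (t k - t j)
        = (-1 : ℝ) ^ k * ∏ j ∈ (Finset.range (d - 1)).erase k, |t k - t j| := by
      have e1 : ∀ j ∈ (Finset.range (d - 1)).erase k,
          t k - t j = (if j < k then (-1 : ℝ) else 1) * |t k - t j| := by
        intro j hj
        rw [Finset.mem_erase, Finset.mem_range] at hj
        split_ifs with h
        · have := ht j k h hk'
          rw [abs_of_neg (by linarith)]; ring
        · have := ht k j (by omega) hj.2
          rw [abs_of_pos (by linarith)]; ring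
      rw [Finset.prod_congr rfl e1, Finset.prod_mul_distrib, Finset.prod_ite]
      simp only [Finset.prod_const, one_pow, mul_one]
      congr 2
      · have : ((Finset.range (d - 1)).erase k).filter (· < k) = Finset.range k := by
          ext j; simp; omega
        rw [this, Finset.card_range]
    have hpos : 0 < ∏ j ∈ (Finset.range (d - 1)).erase k, |t k - t j| := by
      apply Finset.prod_pos
      intro j hj
      rw [Finset.mem_erase, Finset.mem_range] at hj
      apply abs_pos.2
      intro h
      exact hj.1 (hinj (by simpa using hj.2) (by simpa using hk') (by linarith))
    have hsk := hs k hk'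
    rw [hu] at hsk
    simp only [Polynomial.eval_mul, Polynomial.eval_pow, Polynomial.eval_sub, Polynomial.eval_X,
      Polynomial.eval_C] at hsk
    have hue : (-1 : ℝ) ^ k * u.eval (t k) ≤ 0 := by
      by_contra hcon
      push Not at hcon
      nlinarith [mul_nonneg (sq_nonneg (t k - t0)) hcon.le]
    rw [hprod]
    rcases neg_one_pow_eq_or ℝ k with h | h
    · rw [h] at hue ⊢
      exact div_nonpos_of_nonpos_of_nonneg (by linarith) (by linarith)
    · rw [h] at hue ⊢
      exact div_nonpos_of_nonneg_of_nonpos (by linarith) (by linarith)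
  have := Finset.sum_nonpos hneg
  linarith

lemma kel_cheb (d : ℕ) : ∃ c s : Polynomial ℝ, c.natDegree ≤ d ∧ c.coeff d = 1 ∧
    s.natDegree ≤ d ∧ s.coeff d = 0 ∧
    ∀ τ : ℝ, Real.sin τ ≠ 0 →
      Real.sin τ ^ d * c.eval (Real.cos τ / Real.sin τ) = Real.cos (d * τ) ∧
      Real.sin τ ^ d * s.eval (Real.cos τ / Real.sin τ) = Real.sin (d * τ) := by
  induction d with
  | zero => exact ⟨1, 0, by simp⟩
  | succ d ih =>
    obtain ⟨c, s, h1, h2, h3, h4, h5⟩ := ih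
    refine ⟨Polynomial.X * c - s, Polynomial.X * s + c, ?_, ?_, ?_, ?_, ?_⟩
    · refine (Polynomial.natDegree_sub_le _ _).trans (max_le ?_ (by omega))
      refine Polynomial.natDegree_mul_le.trans ?_
      have := Polynomial.natDegree_X_le (R := ℝ); omega
    · rw [Polynomial.coeff_sub, Polynomial.coeff_X_mul, h2,
        Polynomial.coeff_eq_zero_of_natDegree_lt (by omega)]; simp
    · refine (Polynomial.natDegree_add_le _ _).trans (max_le ?_ (by omega))
      refine Polynomial.natDegree_mul_le.trans ?_
      have := Polynomial.natDegree_X_le (R := ℝ); omega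
    · rw [Polynomial.coeff_add, Polynomial.coeff_X_mul, h4,
        Polynomial.coeff_eq_zero_of_natDegree_lt (by omega)]; simp
    · intro τ hτ
      obtain ⟨a, b⟩ := h5 τ hτ
      simp only [Polynomial.eval_sub, Polynomial.eval_add, Polynomial.eval_mul, Polynomial.eval_X]
      have e : ((d + 1 : ℕ) : ℝ) * τ = d * τ + τ := by push_cast; ring
      rw [e, Real.cos_add, Real.sin_add, ← a, ← b]
      constructor
      · field_simp
        ring
      · field_simp
        ring

/-- Comparison lemma. -/
lemma kel_cmp (d : ℕ) (hd : 1 ≤ d) (h : Polynomial ℝ) (M R : ℝ) (hMR : M < R)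
    (hdeg : h.natDegree ≤ d) (hlc : h.coeff d ≤ M)
    (hb : ∀ τ, 0 < τ → τ < Real.pi →
      |Real.sin τ ^ d * h.eval (Real.cos τ / Real.sin τ)| ≤ M)
    (τ0 : ℝ) (hτ0 : 0 < τ0) (hτ1 : τ0 < Real.pi)
    (hv : Real.sin τ0 ^ d * h.eval (Real.cos τ0 / Real.sin τ0) = R * Real.cos (d * τ0))
    (hder : HasDerivAt (fun τ => Real.sin τ ^ d * h.eval (Real.cos τ / Real.sin τ))
      (- (R * (d * Real.sin (d * τ0)))) τ0) : False := by
  obtain ⟨c, s, h1, h2, -, -, h5⟩ := kel_cheb d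
  have hs0 : 0 < Real.sin τ0 := Real.sin_pos_of_pos_of_lt_pi hτ0 hτ1
  set g : Polynomial ℝ := Polynomial.C R * c - h with hg
  have hdpos : (0 : ℝ) < d := by exact_mod_cast hd
  have hang : ∀ k < d - 1, 0 < ((k : ℝ) + 1) * Real.pi / d ∧ ((k : ℝ) + 1) * Real.pi / d < Real.pi := by
    intro k hk
    have : (k : ℝ) + 1 < d := by exact_mod_cast (by omega : k + 1 < d)
    refine ⟨by positivity, ?_⟩
    rw [div_lt_iff₀ hdpos]
    nlinarith [Real.pi_pos]
  have hg0 : g.eval (Real.cos τ0 / Real.sin τ0) = 0 := by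
    have := (h5 τ0 hs0.ne').1
    have hp : Real.sin τ0 ^ d ≠ 0 := by positivity
    apply mul_left_cancel₀ hp
    simp only [hg, Polynomial.eval_sub, Polynomial.eval_mul, Polynomial.eval_C]
    linear_combination R * this - hv
  refine kel_dd d (fun k => Real.cos (((k : ℝ) + 1) * Real.pi / d) / Real.sin (((k : ℝ) + 1) * Real.pi / d))
    hd ?_ g ?_ ?_ ?_ (Real.cos τ0 / Real.sin τ0) hg0 ?_
  · intro j k hjk hk
    obtain ⟨a1, a2⟩ := hang j (by omega)
    obtain ⟨b1, b2⟩ := hang k hk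
    have hlt : ((j : ℝ) + 1) * Real.pi / d < ((k : ℝ) + 1) * Real.pi / d := by
      have : (j : ℝ) < k := by exact_mod_cast hjk
      gcongr
    have sa := Real.sin_pos_of_pos_of_lt_pi a1 a2
    have sb := Real.sin_pos_of_pos_of_lt_pi b1 b2
    have := Real.sin_pos_of_pos_of_lt_pi (sub_pos.2 hlt) (by linarith)
    rw [Real.sin_sub] at this
    rw [div_lt_div_iff₀ sb sa]
    linarith
  · refine (Polynomial.natDegree_sub_le _ _).trans (max_le ?_ hdeg)
    exact (Polynomial.natDegree_C_mul_le _ _).trans h1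
  · rw [hg, Polynomial.coeff_sub, Polynomial.coeff_C_mul, h2]; linarith
  · intro k hk
    obtain ⟨a1, a2⟩ := hang k hk
    set τ := ((k : ℝ) + 1) * Real.pi / d with hτ
    have sa := Real.sin_pos_of_pos_of_lt_pi a1 a2
    have hbt := abs_le.1 (hb τ a1 a2)
    have hct := (h5 τ sa.ne').1
    have hcos : Real.cos (d * τ) = (-1) ^ (k + 1) := by
      have : (d : ℝ) * τ = ((k + 1 : ℕ) : ℝ) * Real.pi := by
        rw [hτ]; push_cast; field_simp
      rw [this, Real.cos_nat_mul_pi]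
    rw [hcos] at hct
    have key : Real.sin τ ^ d * ((-1 : ℝ) ^ k * g.eval (Real.cos τ / Real.sin τ)) < 0 := by
      simp only [hg, Polynomial.eval_sub, Polynomial.eval_mul, Polynomial.eval_C]
      have : Real.sin τ ^ d * ((-1 : ℝ) ^ k * (R * c.eval (Real.cos τ / Real.sin τ) - h.eval (Real.cos τ / Real.sin τ)))
        = (-1 : ℝ) ^ k * (R * (-1) ^ (k + 1) - Real.sin τ ^ d * h.eval (Real.cos τ / Real.sin τ)) := by
        rw [← hct]; ring
      rw [this]
      rcases neg_one_pow_eq_or ℝ k with h | h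
      · rw [pow_succ, h]; linarith
      · rw [pow_succ, h]; linarith
    have hp : 0 < Real.sin τ ^ d := by positivity
    by_contra hcon
    push Not at hcon
    exact absurd (mul_nonneg hp.le hcon) (not_le.2 key)
  · -- derivative
    have hcot : HasDerivAt (fun τ => Real.cos τ / Real.sin τ) (-1 / Real.sin τ0 ^ 2) τ0 := by
      have hq := (Real.hasDerivAt_cos τ0).div (Real.hasDerivAt_sin τ0) hs0.ne'
      have he : (-Real.sin τ0 * Real.sin τ0 - Real.cos τ0 * Real.cos τ0) / Real.sin τ0 ^ 2
          = -1 / Real.sin τ0 ^ 2 := by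
        congr 1
        linarith [Real.sin_sq_add_cos_sq τ0]
      rw [he] at hq
      exact hq
    have hA : HasDerivAt (fun τ => Real.sin τ ^ d * g.eval (Real.cos τ / Real.sin τ))
        (d * Real.sin τ0 ^ (d - 1) * Real.cos τ0 * g.eval (Real.cos τ0 / Real.sin τ0)
          + Real.sin τ0 ^ d * (g.derivative.eval (Real.cos τ0 / Real.sin τ0) * (-1 / Real.sin τ0 ^ 2))) τ0 :=
      ((Real.hasDerivAt_sin τ0).pow d).mul
        (HasDerivAt.comp (h₂ := fun y => g.eval y) τ0 (g.hasDerivAt (Real.cos τ0 / Real.sin τ0)) hcot)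
    have hcosd : HasDerivAt (fun τ : ℝ => R * Real.cos (d * τ)) (- (R * (d * Real.sin (d * τ0)))) τ0 := by
      have h1 : HasDerivAt (fun τ : ℝ => (d : ℝ) * τ) d τ0 := by
        simpa using (hasDerivAt_id τ0).const_mul (d : ℝ)
      have h2 := (h1.cos).const_mul R
      have he : R * (-Real.sin (d * τ0) * d) = - (R * (d * Real.sin (d * τ0))) := by ring
      rw [he] at h2
      exact h2
    have hB := hcosd.sub hder
    have hEq : (fun τ => Real.sin τ ^ d * g.eval (Real.cos τ / Real.sin τ)) =ᶠ[nhds τ0]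
        ((fun τ : ℝ => R * Real.cos (d * τ)) - fun τ => Real.sin τ ^ d * h.eval (Real.cos τ / Real.sin τ)) := by
      have : ∀ᶠ τ in nhds τ0, Real.sin τ ≠ 0 :=
        Real.continuous_sin.continuousAt.eventually_ne hs0.ne'
      filter_upwards [this] with τ hτ
      simp only [hg, Polynomial.eval_sub, Polynomial.eval_mul, Polynomial.eval_C, Pi.sub_apply]
      rw [← (h5 τ hτ).1]; ring
    have := hA.unique (hB.congr_of_eventuallyEq hEq)
    rw [hg0] at this
    simp only [mul_zero, zero_add, sub_self] at this
    have hne : Real.sin τ0 ^ d * (-1 / Real.sin τ0 ^ 2) ≠ 0 := by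
      apply mul_ne_zero (by positivity)
      exact div_ne_zero (by norm_num) (by positivity)
    have h2 : g.derivative.eval (Real.cos τ0 / Real.sin τ0) * (Real.sin τ0 ^ d * (-1 / Real.sin τ0 ^ 2)) = 0 := by
      rw [← this]; ring
    exact (mul_eq_zero.1 h2).resolve_right hne

lemma kel_eval_dirD {n : ℕ} (v x : Fin (n + 1) → ℝ) (p : MvPolynomial (Fin (n + 1)) ℝ) :
    eval x (dirD v p) = ∑ j, v j * eval x (pderiv j p) := by
  simp [dirD]

lemma kel_dirD_lin {n : ℕ} (a b : ℝ) (v w x : Fin (n + 1) → ℝ) (p : MvPolynomial (Fin (n + 1)) ℝ) :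
    eval x (dirD (a • v + b • w) p) = a * eval x (dirD v p) + b * eval x (dirD w p) := by
  simp only [kel_eval_dirD, Finset.mul_sum, ← Finset.sum_add_distrib]
  refine Finset.sum_congr rfl fun j _ => ?_
  simp; ring

lemma kel_dirD_self {n d : ℕ} (x : Fin (n + 1) → ℝ) (p : MvPolynomial (Fin (n + 1)) ℝ)
    (hp : p.IsHomogeneous d) : eval x (dirD x p) = d * eval x p := by
  have := congrArg (eval x) hp.sum_X_mul_pderiv
  rw [kel_eval_dirD]
  simpa using this

lemma kel_dirD_hom {n d : ℕ} (v : Fin (n + 1) → ℝ) (p : MvPolynomial (Fin (n + 1)) ℝ)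
    (hp : p.IsHomogeneous d) : (dirD v p).IsHomogeneous (d - 1) := by
  apply IsHomogeneous.sum
  intro j _
  exact hp.pderiv.C_mul _

lemma kel_curve {n : ℕ} (γ : ℝ → Fin (n + 1) → ℝ) (γ' : Fin (n + 1) → ℝ) (τ : ℝ)
    (hγ : ∀ j, HasDerivAt (fun s => γ s j) (γ' j) τ) (p : MvPolynomial (Fin (n + 1)) ℝ) :
    HasDerivAt (fun s => eval (γ s) p) (eval (γ τ) (dirD γ' p)) τ := by
  rw [kel_eval_dirD]
  induction p using MvPolynomial.induction_on with
  | C a => simpa using hasDerivAt_const τ a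
  | add p q hp hq =>
    have := hp.add hq
    simp only [map_add, mul_add, Finset.sum_add_distrib]
    exact this
  | mul_X p i hp =>
    have := hp.mul (hγ i)
    simp only [Derivation.leibniz, smul_eq_mul, map_add, map_mul, eval_X, mul_add,
      Finset.sum_add_distrib, pderiv_X]
    have e : (∑ j, γ' j * (eval (γ τ) p * eval (γ τ) (Pi.single (M := fun _ => MvPolynomial (Fin (n+1)) ℝ) j 1 i))
        + ∑ j, γ' j * (γ τ i * eval (γ τ) (pderiv j p)))
        = (∑ j, γ' j * eval (γ τ) (pderiv j p)) * γ τ i + eval (γ τ) p * γ' i := by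
      rw [Finset.sum_eq_single i]
      · rw [Finset.sum_mul, add_comm]
        congr 1
        · exact Finset.sum_congr rfl fun j _ => by ring
        · simp; ring
      · intro j _ hj
        simp [Pi.single_apply, hj.symm]
      · simp
    rw [e]
    exact this

lemma kel_hom_eval {n d : ℕ} (p : MvPolynomial (Fin (n + 1)) ℝ) (hp : p.IsHomogeneous d)
    (r : ℝ) (y : Fin (n + 1) → ℝ) : eval (r • y) p = r ^ d * eval y p := by
  rw [eval_eq', eval_eq', Finset.mul_sum]
  refine Finset.sum_congr rfl fun m hm => ?_
  have hdeg : ∑ j, m j = d := by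
    have := hp (mem_support_iff.1 hm)
    rw [Finsupp.weight_apply, Finsupp.sum_fintype _ _ (by simp)] at this
    simpa using this
  simp only [Pi.smul_apply, smul_eq_mul, mul_pow, Finset.prod_mul_distrib]
  rw [Finset.prod_pow_eq_pow_sum, hdeg]; ring

lemma kel_prod {ι : Type*} (s : Finset ι) (a b : ι → ℝ) (m : ι → ℕ) :
    (∏ j ∈ s, (Polynomial.C (a j) * Polynomial.X + Polynomial.C (b j)) ^ m j).natDegree ≤ ∑ j ∈ s, m j ∧
    (∏ j ∈ s, (Polynomial.C (a j) * Polynomial.X + Polynomial.C (b j)) ^ m j).coeff (∑ j ∈ s, m j)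
      = ∏ j ∈ s, a j ^ m j := by
  classical
  have hpow : ∀ (j : ι) , ((Polynomial.C (a j) * Polynomial.X + Polynomial.C (b j)) ^ m j).natDegree ≤ m j := by
    intro j
    refine Polynomial.natDegree_pow_le.trans ?_
    have : (Polynomial.C (a j) * Polynomial.X + Polynomial.C (b j)).natDegree ≤ 1 :=
      Polynomial.natDegree_linear_le
    nlinarith
  induction s using Finset.induction_on with
  | empty => simp
  | insert i s hi ih =>
    rw [Finset.prod_insert hi, Finset.sum_insert hi, Finset.prod_insert hi]
    refine ⟨Polynomial.natDegree_mul_le.trans (add_le_add (hpow i) ih.1), ?_⟩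
    rw [Polynomial.coeff_mul_add_eq_of_natDegree_le (hpow i) ih.1, ih.2]
    congr 1
    have := Polynomial.coeff_pow_of_natDegree_le
      (p := Polynomial.C (a i) * Polynomial.X + Polynomial.C (b i)) (n := 1) (m := m i)
      Polynomial.natDegree_linear_le
    simpa using this

lemma kel_restrict {n d : ℕ} (p : MvPolynomial (Fin (n + 1)) ℝ) (hp : p.IsHomogeneous d)
    (a b : Fin (n + 1) → ℝ) : ∃ h : Polynomial ℝ, h.natDegree ≤ d ∧ h.coeff d = eval a p ∧
      ∀ t, h.eval t = eval (t • a + b) p := by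
  refine ⟨∑ m ∈ p.support, Polynomial.C (p.coeff m) *
    ∏ j, (Polynomial.C (a j) * Polynomial.X + Polynomial.C (b j)) ^ m j, ?_, ?_, ?_⟩
  all_goals
    have hdeg : ∀ m ∈ p.support, ∑ j, m j = d := by
      intro m hm
      have := hp (mem_support_iff.1 hm)
      rw [Finsupp.weight_apply, Finsupp.sum_fintype _ _ (by simp)] at this
      simpa using this
  · apply Polynomial.natDegree_sum_le_of_forall_le
    intro m hm
    refine (Polynomial.natDegree_C_mul_le _ _).trans ?_
    rw [← hdeg m hm]
    exact (kel_prod _ _ _ _).1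
  · rw [eval_eq', Polynomial.finsetSum_coeff]
    refine Finset.sum_congr rfl fun m hm => ?_
    rw [Polynomial.coeff_C_mul, ← hdeg m hm, (kel_prod _ _ _ _).2]
  · intro t
    rw [eval_eq', Polynomial.eval_finsetSum]
    refine Finset.sum_congr rfl fun m hm => ?_
    rw [Polynomial.eval_mul, Polynomial.eval_C, Polynomial.eval_prod]
    congr 1
    refine Finset.prod_congr rfl fun j _ => ?_
    simp only [Polynomial.eval_pow, Polynomial.eval_add, Polynomial.eval_mul, Polynomial.eval_C,
      Polynomial.eval_X, Pi.add_apply, Pi.smul_apply, smul_eq_mul]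
    rw [mul_comm t]

/-- Bernstein–Szegő on a plane, one sign of the derivative. -/
lemma kel_bs {n d : ℕ} (hd : 1 ≤ d) (p : MvPolynomial (Fin (n + 1)) ℝ) (hp : p.IsHomogeneous d)
    (M : ℝ) (hM : ∀ y, vnorm y = 1 → |eval y p| ≤ M) (x w : Fin (n + 1) → ℝ)
    (hx : ∑ j, x j ^ 2 = 1) (hw : ∑ j, w j ^ 2 = 1) (hxw : ∑ j, x j * w j = 0)
    (hneg : eval x (dirD w p) ≤ 0) :
    (d * eval x p) ^ 2 + (eval x (dirD w p)) ^ 2 ≤ (d * M) ^ 2 := by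
  by_contra hcon
  push Not at hcon
  have hdpos : (0 : ℝ) < d := by exact_mod_cast hd
  have hunit : ∀ α β : ℝ, α ^ 2 + β ^ 2 = 1 → |eval (α • x + β • w) p| ≤ M := by
    intro α β h
    apply hM
    have : ∑ j, (α • x + β • w) j ^ 2 = 1 := by
      have e : ∀ j, (α • x + β • w) j ^ 2 = α ^ 2 * x j ^ 2 + β ^ 2 * w j ^ 2 + 2 * α * β * (x j * w j) := by
        intro j; simp; ring
      simp only [e, Finset.sum_add_distrib, ← Finset.mul_sum, hx, hw, hxw]
      linarith
    rw [vnorm, this, Real.sqrt_one]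
  have hTM : |eval x p| ≤ M := by simpa using hunit 1 0 (by norm_num)
  have hM0 : 0 ≤ M := (abs_nonneg _).trans hTM
  set T := eval x p with hT
  set S := eval x (dirD w p) with hS
  set R := Real.sqrt (T ^ 2 + (S / d) ^ 2) with hR
  have hR2 : R ^ 2 = T ^ 2 + (S / d) ^ 2 := Real.sq_sqrt (by positivity)
  have hMR : M < R := by
    apply Real.lt_sqrt_of_sq_lt
    have : (d * T) ^ 2 + S ^ 2 = d ^ 2 * (T ^ 2 + (S / d) ^ 2) := by field_simp
    rw [this, mul_pow] at hcon
    exact lt_of_mul_lt_mul_left hcon (by positivity)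
  have hRpos : 0 < R := lt_of_le_of_lt hM0 hMR
  have hTR := abs_le.1 hTM
  set φ := Real.arccos (T / R) with hφ
  have hφ0 : 0 < φ := by
    rw [hφ, Real.arccos_pos, div_lt_one hRpos]; linarith
  have hφ1 : φ < Real.pi := by
    have : φ ≠ Real.pi := by
      rw [hφ, Ne, Real.arccos_eq_pi, not_le, lt_div_iff₀ hRpos]; linarith
    exact lt_of_le_of_ne (Real.arccos_le_pi _) this
  have hcos : R * Real.cos φ = T := by
    rw [hφ, Real.cos_arccos]
    · field_simp
    · rw [le_div_iff₀ hRpos]; linarith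
    · rw [div_le_one hRpos]; linarith
  have hsin : R * Real.sin φ = - S / d := by
    have h1 : 0 < R * Real.sin φ := mul_pos hRpos (Real.sin_pos_of_pos_of_lt_pi hφ0 hφ1)
    have h2 : 0 ≤ -S / d := div_nonneg (by linarith) hdpos.le
    have h3 : (R * Real.sin φ) ^ 2 = (-S / d) ^ 2 := by
      have := Real.sin_sq_add_cos_sq φ
      have e : (-S / (d : ℝ)) ^ 2 = (S / d) ^ 2 := by ring
      rw [e]
      have h4 : (R * Real.cos φ) ^ 2 = T ^ 2 := by rw [hcos]
      nlinarith
    exact (pow_left_inj₀ h1.le h2 two_ne_zero).1 h3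
  set τ0 := φ / d with hτ0
  have hdτ : (d : ℝ) * τ0 = φ := by rw [hτ0]; field_simp
  have h0 : 0 < τ0 := by positivity
  have h1 : τ0 < Real.pi := by
    have : (1 : ℝ) ≤ d := by exact_mod_cast hd
    refine lt_of_le_of_lt ?_ hφ1
    rw [hτ0]; exact div_le_self hφ0.le this
  have hcs := Real.sin_sq_add_cos_sq τ0
  let e1 : Fin (n + 1) → ℝ := Real.cos τ0 • x + (- Real.sin τ0) • w
  let e2 : Fin (n + 1) → ℝ := Real.sin τ0 • x + Real.cos τ0 • w
  obtain ⟨h, hdeg, hlc, hev⟩ := kel_restrict p hp e1 e2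
  let γ : ℝ → Fin (n + 1) → ℝ := fun τ => Real.cos τ • e1 + Real.sin τ • e2
  have hγ : ∀ τ, Real.sin τ ≠ 0 → Real.sin τ ^ d * h.eval (Real.cos τ / Real.sin τ) = eval (γ τ) p := by
    intro τ hτ
    rw [hev, ← kel_hom_eval p hp]
    congr 2
    funext j
    simp [γ]
    field_simp
  have hγ0 : γ τ0 = x := by
    funext j
    simp [γ, e1, e2]
    linear_combination (x j) * hcs
  have hs0 := Real.sin_pos_of_pos_of_lt_pi h0 h1
  refine kel_cmp d hd h M R hMR hdeg ?_ ?_ τ0 h0 h1 ?_ ?_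
  · rw [hlc]
    refine (le_abs_self _).trans (hunit _ _ ?_)
    linarith [neg_sq (Real.sin τ0)]
  · intro τ ha hb
    rw [hγ τ (Real.sin_pos_of_pos_of_lt_pi ha hb).ne']
    have : γ τ = (Real.cos τ * Real.cos τ0 + Real.sin τ * Real.sin τ0) • x
        + (Real.sin τ * Real.cos τ0 - Real.cos τ * Real.sin τ0) • w := by
      funext j
      simp [γ, e1, e2]
      ring
    rw [this]
    apply hunit
    rw [← Real.cos_sub, ← Real.sin_sub]
    exact Real.cos_sq_add_sin_sq _
  · rw [hγ τ0 hs0.ne', hγ0, hdτ, hcos]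
  · have hc := kel_curve γ w τ0 (by
      intro j
      have := ((Real.hasDerivAt_cos τ0).mul_const (e1 j)).add ((Real.hasDerivAt_sin τ0).mul_const (e2 j))
      have he : -Real.sin τ0 * e1 j + Real.cos τ0 * e2 j = w j := by
        simp [e1, e2]
        linear_combination (w j) * hcs
      rw [he] at this
      exact this) p
    rw [hγ0, ← hS] at hc
    have he : - (R * (d * Real.sin (d * τ0))) = S := by
      rw [hdτ]
      have : R * (d * Real.sin φ) = d * (R * Real.sin φ) := by ring
      rw [this, hsin]; field_simp
    rw [he]
    refine hc.congr_of_eventuallyEq ?_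
    have : ∀ᶠ τ in nhds τ0, Real.sin τ ≠ 0 :=
      Real.continuous_sin.continuousAt.eventually_ne hs0.ne'
    filter_upwards [this] with τ hτ
    exact hγ τ hτ

lemma kel_bs' {n d : ℕ} (hd : 1 ≤ d) (p : MvPolynomial (Fin (n + 1)) ℝ) (hp : p.IsHomogeneous d)
    (M : ℝ) (hM : ∀ y, vnorm y = 1 → |eval y p| ≤ M) (x w : Fin (n + 1) → ℝ)
    (hx : ∑ j, x j ^ 2 = 1) (hw : ∑ j, w j ^ 2 = 1) (hxw : ∑ j, x j * w j = 0) :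
    (d * eval x p) ^ 2 + (eval x (dirD w p)) ^ 2 ≤ (d * M) ^ 2 := by
  rcases le_total (eval x (dirD w p)) 0 with h | h
  · exact kel_bs hd p hp M hM x w hx hw hxw h
  · have e : eval x (dirD (-w) p) = - eval x (dirD w p) := by
      simp [kel_eval_dirD]
    have := kel_bs hd p hp M hM x (-w) hx (by simpa using hw) (by simpa using hxw) (by rw [e]; linarith)
    rwa [e, neg_sq] at this

lemma kel_vnorm_nonneg {m : ℕ} (v : Fin m → ℝ) : 0 ≤ vnorm v := Real.sqrt_nonneg _

lemma kel_vnorm_sq {m : ℕ} (v : Fin m → ℝ) : vnorm v ^ 2 = ∑ j, v j ^ 2 :=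
  Real.sq_sqrt (Finset.sum_nonneg fun j _ => sq_nonneg _)

lemma kel_step {n d : ℕ} (p : MvPolynomial (Fin (n + 1)) ℝ) (hp : p.IsHomogeneous d)
    (M : ℝ) (hM : ∀ y, vnorm y = 1 → |eval y p| ≤ M) (x v : Fin (n + 1) → ℝ) (hx : vnorm x = 1) :
    |eval x (dirD v p)| ≤ d * M * vnorm v := by
  have hM0 : 0 ≤ M := (abs_nonneg _).trans (hM x hx)
  rcases Nat.eq_zero_or_pos d with rfl | hd
  · have hC := hp
    rw [← totalDegree_zero_iff_isHomogeneous, totalDegree_eq_zero_iff_eq_C] at hC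
    rw [hC]
    simp [dirD]
  have hx2 : ∑ j, x j ^ 2 = 1 := by rw [← kel_vnorm_sq, hx]; norm_num
  set a := ∑ j, x j * v j with ha
  set u : Fin (n + 1) → ℝ := v - a • x with hu
  have hxu : ∑ j, x j * u j = 0 := by
    have : ∀ j, x j * u j = x j * v j - a * x j ^ 2 := by intro j; simp [hu]; ring
    simp only [this, Finset.sum_sub_distrib, ← Finset.mul_sum, hx2]
    rw [← ha]; ring
  have hv : v = a • x + (1 : ℝ) • u := by simp [hu]
  have hv2 : vnorm v ^ 2 = a ^ 2 + vnorm u ^ 2 := by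
    rw [kel_vnorm_sq, kel_vnorm_sq]
    have : ∀ j, v j ^ 2 = a ^ 2 * x j ^ 2 + u j ^ 2 + 2 * a * (x j * u j) := by
      intro j; simp [hu]; ring
    simp only [this, Finset.sum_add_distrib, ← Finset.mul_sum, hx2, hxu]
    ring
  have hb := kel_vnorm_nonneg u
  have hdM : 0 ≤ (d : ℝ) * M := by positivity
  apply abs_le_of_sq_le_sq _ (mul_nonneg hdM (kel_vnorm_nonneg v))
  rw [mul_pow, hv2]
  rcases hb.eq_or_lt with hb0 | hb0
  · have hu0 : u = 0 := by
      have h2 := kel_vnorm_sq u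
      rw [← hb0] at h2
      have h3 : ∑ j, u j ^ 2 = 0 := by rw [← h2]; norm_num
      rw [Finset.sum_eq_zero_iff_of_nonneg (fun j _ => sq_nonneg _)] at h3
      funext j
      simpa using h3 j (Finset.mem_univ j)
    rw [hv, kel_dirD_lin, kel_dirD_self x p hp, hu0]
    have : eval x (dirD (0 : Fin (n + 1) → ℝ) p) = 0 := by simp [kel_eval_dirD]
    have h1 := abs_le.1 (hM x hx)
    have h2 : (eval x p) ^ 2 ≤ M ^ 2 := sq_le_sq' h1.1 h1.2
    have h3 : vnorm (0 : Fin (n + 1) → ℝ) = 0 := by simp [vnorm]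
    rw [this, h3]
    have := mul_le_mul_of_nonneg_left h2 (by positivity : 0 ≤ (a * d) ^ 2)
    nlinarith
  · set b := vnorm u with hbdef
    set w : Fin (n + 1) → ℝ := b⁻¹ • u with hw
    have huw : u = b • w := by rw [hw, smul_smul, mul_inv_cancel₀ hb0.ne', one_smul]
    have hw1 : ∑ j, w j ^ 2 = 1 := by
      simp only [hw, Pi.smul_apply, smul_eq_mul, mul_pow, ← Finset.mul_sum]
      rw [← kel_vnorm_sq, ← hbdef]; field_simp
    have hxw : ∑ j, x j * w j = 0 := by
      have : ∀ j, x j * w j = b⁻¹ * (x j * u j) := by intro j; simp [hw]; ring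
      simp only [this, ← Finset.mul_sum, hxu, mul_zero]
    have hv' : v = a • x + b • w := by rw [← huw]; simpa using hv
    have key := kel_bs' hd p hp M hM x w hx2 hw1 hxw
    have hexp : eval x (dirD v p) = a * (d * eval x p) + b * eval x (dirD w p) := by
      conv_lhs => rw [hv', kel_dirD_lin, kel_dirD_self x p hp]
    rw [hexp]
    have := mul_le_mul_of_nonneg_left key (by positivity : 0 ≤ a ^ 2 + b ^ 2)
    nlinarith [sq_nonneg (a * eval x (dirD w p) - b * (d * eval x p))]

lemma kel_iter {n : ℕ} (k : ℕ) : ∀ (d : ℕ) (p : MvPolynomial (Fin (n + 1)) ℝ)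
    (_ : p.IsHomogeneous d) (M : ℝ) (_ : ∀ y, vnorm y = 1 → |eval y p| ≤ M)
    (v : Fin k → (Fin (n + 1) → ℝ)) (x : Fin (n + 1) → ℝ) (_ : vnorm x = 1),
    |eval x (iterD k v p)| ≤ d.descFactorial k * M * ∏ l, vnorm (v l) := by
  induction k with
  | zero =>
    intro d p hp M hM v x hx
    simpa [iterD] using hM x hx
  | succ k ih =>
    intro d p hp M hM v x hx
    have := ih (d - 1) (dirD (v 0) p) (kel_dirD_hom _ p hp) (d * M * vnorm (v 0))
      (fun y hy => kel_step p hp M hM y (v 0) hy) (fun l => v l.succ) x hx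
    rw [iterD]
    refine this.trans (le_of_eq ?_)
    rw [Fin.prod_univ_succ]
    rcases d with _ | d
    · simp
    · rw [Nat.succ_descFactorial_succ]
      push_cast
      ring

lemma kel_le_sup {n q : ℕ} (f : Fin q → MvPolynomial (Fin (n + 1)) ℝ) (i : Fin q)
    (x : Fin (n + 1) → ℝ) (hx : vnorm x = 1) : |eval x (f i)| ≤ polySupNorm f := by
  have hcomp : IsCompact {x : Fin (n + 1) → ℝ | vnorm x = 1} := by
    apply Metric.isCompact_of_isClosed_isBounded
    · apply isClosed_eq _ continuous_const
      unfold vnorm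
      fun_prop
    · refine (Metric.isBounded_closedBall (x := (0 : Fin (n + 1) → ℝ)) (r := 1)).subset ?_
      intro y hy
      rw [mem_closedBall_zero_iff, pi_norm_le_iff_of_nonneg zero_le_one]
      intro j
      have h2 := kel_vnorm_sq y
      have hy1 : vnorm y = 1 := hy
      rw [hy1] at h2
      have h3 := Finset.single_le_sum (f := fun j => y j ^ 2) (fun j _ => sq_nonneg _) (Finset.mem_univ j)
      rw [Real.norm_eq_abs]
      exact abs_le_one_iff_mul_self_le_one.2 (by nlinarith)
  have hcont : Continuous fun y : Fin (n + 1) → ℝ => ∑ i, |eval y (f i)| := by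
    refine continuous_finsetSum _ fun i _ => ?_
    exact (MvPolynomial.continuous_eval (f i)).abs
  obtain ⟨B, hB⟩ := (hcomp.image hcont).bddAbove
  have hfin : ∀ y : Fin (n + 1) → ℝ, BddAbove (Set.range fun i => |eval y (f i)|) :=
    fun y => (Set.finite_range _).bddAbove
  have hbdd : BddAbove (Set.range fun y : {x : Fin (n + 1) → ℝ // vnorm x = 1} =>
      ⨆ i : Fin q, |eval y.1 (f i)|) := by
    refine ⟨B, ?_⟩
    rintro _ ⟨y, rfl⟩
    have : Nonempty (Fin q) := ⟨i⟩
    refine le_trans (ciSup_le fun j => ?_) (hB ⟨y.1, y.2, rfl⟩)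
    exact Finset.single_le_sum (f := fun j => |eval y.1 (f j)|) (fun j _ => abs_nonneg _) (Finset.mem_univ j)
  exact (le_ciSup (hfin x) i).trans (le_ciSup hbdd ⟨x, hx⟩)

/-- Corollary 2.20, real case: higher-derivative Kellogg estimate. -/
theorem kellogg_higher_derivative (n q : ℕ) (hn : 1 ≤ n) (hq : 1 ≤ q) (d : Fin q → ℕ)
    (hd : ∀ i, 1 ≤ d i) (f : Fin q → MvPolynomial (Fin (n + 1)) ℝ)
    (hf : ∀ i, (f i).IsHomogeneous (d i))
    (D : ℕ) (hD : D = Finset.univ.sup d)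
    (k : ℕ) (hk : 1 ≤ k) (v : Fin k → (Fin (n + 1) → ℝ))
    (x : Fin (n + 1) → ℝ) (hx : vnorm x = 1) (i : Fin q) :
    (1 / ((Nat.factorial k : ℝ) * (d i : ℝ))) * |eval x (iterD k v (f i))| ≤
      (1 / (k : ℝ)) * ((D - 1).choose (k - 1) : ℝ) * polySupNorm f * ∏ l, vnorm (v l) := by


  have h := kel_iter k (d i) (f i) (hf i) (polySupNorm f) (fun y hy => kel_le_sup f i y hy) v x hx
  have hM0 : 0 ≤ polySupNorm f := (abs_nonneg _).trans (kel_le_sup f i x hx)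
  have hP : 0 ≤ ∏ l, vnorm (v l) := Finset.prod_nonneg fun l _ => kel_vnorm_nonneg _
  have hdi : d i ≤ D := by rw [hD]; exact Finset.le_sup (f := d) (Finset.mem_univ i)
  have hch : (((d i - 1).choose (k - 1) : ℕ) : ℝ) ≤ ((D - 1).choose (k - 1) : ℕ) := by
    exact_mod_cast Nat.choose_le_choose (k - 1) (by omega)
  have hdpos : (0 : ℝ) < d i := by exact_mod_cast hd i
  have hkpos : (0 : ℝ) < k := by exact_mod_cast hk
  have hfpos : (0 : ℝ) < Nat.factorial k := by exact_mod_cast Nat.factorial_pos k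
  have hid : 1 / ((Nat.factorial k : ℝ) * (d i : ℝ)) * (d i).descFactorial k
      = 1 / (k : ℝ) * ((d i - 1).choose (k - 1) : ℕ) := by
    obtain ⟨e, he⟩ : ∃ e, d i = e + 1 := ⟨d i - 1, by have := hd i; omega⟩
    obtain ⟨m, rfl⟩ : ∃ m, k = m + 1 := ⟨k - 1, by omega⟩
    have h1 : ((e + 1).descFactorial (m + 1) * (m + 1) : ℕ)
        = (m + 1).factorial * (e + 1) * e.choose m := by
      rw [Nat.succ_descFactorial_succ, Nat.descFactorial_eq_factorial_mul_choose, Nat.factorial_succ]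
      ring
    have h2 : (((e + 1).descFactorial (m + 1) : ℕ) : ℝ) * ((m + 1 : ℕ) : ℝ)
        = ((m + 1).factorial : ℝ) * ((e + 1 : ℕ) : ℝ) * (e.choose m : ℝ) := by
      exact_mod_cast h1
    rw [he] at hdpos ⊢
    simp only [Nat.add_sub_cancel]
    rw [one_div_mul_eq_div, one_div_mul_eq_div, div_eq_div_iff (by positivity) (by positivity), h2]
    ring
  calc (1 / ((Nat.factorial k : ℝ) * (d i : ℝ))) * |eval x (iterD k v (f i))|
      ≤ (1 / ((Nat.factorial k : ℝ) * (d i : ℝ))) *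
        ((d i).descFactorial k * polySupNorm f * ∏ l, vnorm (v l)) :=
        mul_le_mul_of_nonneg_left h (by positivity)
    _ = (1 / (k : ℝ)) * ((d i - 1).choose (k - 1) : ℕ) * polySupNorm f * ∏ l, vnorm (v l) := by
        rw [← hid]; ring
    _ ≤ _ := by gcongr
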